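/- Let n ≥ 1 and let W be the complex vector space of finitely supported functions ℤ_{≥0}^n → ℂ with basis {|α⟩}. Let q, ν₁, ν₂, ν₃ ∈ ℂ with q nonzero and not a root of unity, ν₁ ≠ 0, ν₂ ≠ 0, and (ν₂;q)_m ≠ 0 and (ν₃;q)_m ≠ 0 for all m ≥ 1. For parameters (λ,μ), define the linear map S(λ,μ) on W ⊗ W by S(λ,μ)(|α⟩⊗|β⟩) = Σ_{γ,δ ∈ ℤ_{≥0}^n, γ+δ=α+β} Φ_q^{(n)}(γ|β;λ,μ) |γ⟩⊗|δ⟩ (a finite sum). Let S_{ij}(λ,μ) act as S(λ,μ) on the i-th and j-th factors of W⊗W⊗W and as the identity on the remaining factor. Then S_{12}(ν₁,ν₂) S_{13}(ν₁,ν₃) S_{23}(ν₂,ν₃) = S_{23}(ν₂,ν₃) S_{13}(ν₁,ν₃) S_{12}(ν₁,ν₂) as linear maps on W⊗W⊗W (the Yang–Baxter equation for the stochastic R matrix). -/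

import Mathlib

/-- The q-Pochhammer symbol `(z;q)_m = ∏_{j=0}^{m-1} (1 - z q^j)`. -/
noncomputable def qPoch (q z : ℂ) (m : ℕ) : ℂ := ∏ j ∈ Finset.range m, (1 - z * q ^ j)

/-- The q-binomial coefficient `binom(m,k)_q`. -/
noncomputable def qBinom (q : ℂ) (m k : ℕ) : ℂ :=
  if k ≤ m then qPoch q q m / (qPoch q q k * qPoch q q (m - k)) else 0

/-- `q` is not a root of unity. -/
def notRootOfUnity (q : ℂ) : Prop := ∀ m : ℕ, 0 < m → q ^ m ≠ 1

/-- `φ(β,γ) = Σ_{1 ≤ i < j ≤ k} β_i γ_j` for integer vectors. -/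
def phi {k : ℕ} (β γ : Fin k → ℤ) : ℤ :=
  ∑ i, ∑ j, if i < j then β i * γ j else 0

open Classical in
/-- The weight `Φ_q^{(n)}(γ|β;λ,μ)` of the stochastic R matrix of `U_q(A^{(1)}_n)`. -/
noncomputable def Phi (n : ℕ) (q lam mu : ℂ) (γ β : Fin n → ℕ) : ℂ :=
  if γ ≤ β then
    q ^ phi (fun i => (β i : ℤ) - (γ i : ℤ)) (fun i => (γ i : ℤ))
      * (mu / lam) ^ (∑ i, γ i)
      * qPoch q lam (∑ i, γ i) * qPoch q (mu / lam) ((∑ i, β i) - ∑ i, γ i)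
      * (∏ i, qBinom q (β i) (γ i)) / qPoch q mu (∑ i, β i)
  else 0

/-- Local states of the `U_q(A^{(1)}_n)` model. -/
abbrev LocalState (n : ℕ) := Fin n → ℕ

/-- `W ⊗ W ⊗ W`, realized as finitely supported functions on triples of basis labels. -/
abbrev W3 (n : ℕ) := (LocalState n × LocalState n × LocalState n) →₀ ℂ

/-- The stochastic R matrix acting on the first and second tensor factors:
`S(λ,μ)(|α⟩⊗|β⟩) = Σ_{γ+δ=α+β} Φ_q^{(n)}(γ|β;λ,μ) |γ⟩⊗|δ⟩`. -/
noncomputable def S12 (n : ℕ) (q lam mu : ℂ) : W3 n →ₗ[ℂ] W3 n :=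
  Finsupp.lsum ℂ fun x => LinearMap.toSpanSingleton ℂ (W3 n)
    (∑ γ ∈ Finset.Iic (x.1 + x.2.1),
      Phi n q lam mu γ x.2.1 • Finsupp.single (γ, x.1 + x.2.1 - γ, x.2.2) 1)

/-- The stochastic R matrix acting on the first and third tensor factors. -/
noncomputable def S13 (n : ℕ) (q lam mu : ℂ) : W3 n →ₗ[ℂ] W3 n :=
  Finsupp.lsum ℂ fun x => LinearMap.toSpanSingleton ℂ (W3 n)
    (∑ γ ∈ Finset.Iic (x.1 + x.2.2),
      Phi n q lam mu γ x.2.2 • Finsupp.single (γ, x.2.1, x.1 + x.2.2 - γ) 1)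

/-- The stochastic R matrix acting on the second and third tensor factors. -/
noncomputable def S23 (n : ℕ) (q lam mu : ℂ) : W3 n →ₗ[ℂ] W3 n :=
  Finsupp.lsum ℂ fun x => LinearMap.toSpanSingleton ℂ (W3 n)
    (∑ γ ∈ Finset.Iic (x.2.1 + x.2.2),
      Phi n q lam mu γ x.2.2 • Finsupp.single (x.1, γ, x.2.1 + x.2.2 - γ) 1)

open Finset

lemma qPoch_succ (q z : ℂ) (m : ℕ) : qPoch q z (m + 1) = qPoch q z m * (1 - z * q ^ m) :=
  Finset.prod_range_succ _ _

lemma qPoch_zero (q z : ℂ) : qPoch q z 0 = 1 := rfl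

lemma qPoch_self_ne_zero {q : ℂ} (hq : notRootOfUnity q) (m : ℕ) : qPoch q q m ≠ 0 := by
  refine Finset.prod_ne_zero_iff.2 fun j _ h => hq (j + 1) j.succ_pos ?_
  rw [pow_succ']
  exact (sub_eq_zero.1 h).symm

lemma qBinom_eq_zero (q : ℂ) {m k : ℕ} (h : m < k) : qBinom q m k = 0 :=
  if_neg h.not_ge

lemma qBinom_add (q : ℂ) (k l : ℕ) :
    qBinom q (k + l) k = qPoch q q (k + l) / (qPoch q q k * qPoch q q l) := by
  simp [qBinom]

lemma qBinom_zero_right {q : ℂ} (hq : notRootOfUnity q) (m : ℕ) : qBinom q m 0 = 1 := by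
  simp [qBinom, qPoch_zero, qPoch_self_ne_zero hq]

lemma qBinom_self {q : ℂ} (hq : notRootOfUnity q) (m : ℕ) : qBinom q m m = 1 := by
  simp [qBinom, qPoch_zero, qPoch_self_ne_zero hq]

lemma qBinom_symm (q : ℂ) (k l : ℕ) : qBinom q (k + l) k = qBinom q (k + l) l := by
  rw [qBinom_add, add_comm k l, qBinom_add, mul_comm]

/-- The `q`-Pascal rule. -/
lemma qBinom_succ_succ {q : ℂ} (hq : notRootOfUnity q) (m k : ℕ) :
    qBinom q (m + 1) (k + 1) = qBinom q m k + q ^ (k + 1) * qBinom q m (k + 1) := by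
  rcases lt_trichotomy m k with h | rfl | h
  · simp [qBinom_eq_zero q h, qBinom_eq_zero q (show m < k + 1 by lia),
      qBinom_eq_zero q (show m + 1 < k + 1 by lia)]
  · simp [qBinom_self hq, qBinom_eq_zero q (Nat.lt_succ_self m)]
  · obtain ⟨l, rfl⟩ := Nat.exists_eq_add_of_lt h
    have hk := qPoch_self_ne_zero hq (k + 1)
    have hl := qPoch_self_ne_zero hq (l + 1)
    rw [show k + l + 1 + 1 = (k + 1) + (l + 1) by ring, qBinom_add,
      show k + l + 1 = k + (l + 1) by ring, qBinom_add,
      show k + (l + 1) = (k + 1) + l by ring, qBinom_add,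
      show k + 1 + (l + 1) = (k + 1 + l) + 1 by ring, qPoch_succ q q (k + 1 + l)]
    rw [qPoch_succ] at hk hl ⊢
    rw [qPoch_succ q q l]
    simp only [mul_ne_zero_iff] at hk hl
    obtain ⟨hk1, hk2⟩ := hk
    obtain ⟨hl1, hl2⟩ := hl
    field_simp
    ring

/-- Trinomial revision. -/
lemma qBinom_mul_qBinom {q : ℂ} (hq : notRootOfUnity q) (m k l : ℕ) :
    qBinom q m (k + l) * qBinom q (k + l) k = qBinom q m k * qBinom q (m - k) l := by
  rcases le_or_gt (k + l) m with h | h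
  · obtain ⟨s, rfl⟩ := Nat.exists_eq_add_of_le h
    rw [qBinom_add, qBinom_add, show k + l + s = k + (l + s) by ring, qBinom_add,
      Nat.add_sub_cancel_left, qBinom_add]
    have := qPoch_self_ne_zero hq
    field_simp [this]
  · rw [qBinom_eq_zero q h, zero_mul]
    rcases le_or_gt k m with h' | h'
    · rw [qBinom_eq_zero q (show m - k < l by lia), mul_zero]
    · rw [qBinom_eq_zero q h', zero_mul]

lemma sum_qBinom_succ {q : ℂ} (hq : notRootOfUnity q) (N : ℕ) (F : ℕ → ℕ → ℂ) :
    ∑ p ∈ antidiagonal (N + 1), qBinom q (N + 1) p.1 * F p.1 p.2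
      = ∑ p ∈ antidiagonal N,
          qBinom q N p.1 * (q ^ p.1 * F p.1 (p.2 + 1) + F (p.1 + 1) p.2) := by
  rw [Nat.sum_antidiagonal_succ]
  have h := Nat.sum_antidiagonal_succ (n := N)
    (f := fun p => qBinom q N p.1 * q ^ p.1 * F p.1 p.2)
  rw [Nat.sum_antidiagonal_succ'] at h
  simp only [qBinom_eq_zero q (Nat.lt_succ_self N), zero_mul, zero_add, pow_zero, mul_one,
    qBinom_zero_right hq, one_mul] at h
  simp only [qBinom_succ_succ hq, qBinom_zero_right hq, one_mul, mul_add, add_mul,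
    sum_add_distrib]
  simp only [← mul_assoc]
  rw [h]
  simp only [mul_comm (q ^ _) (qBinom q _ _)]
  ring

/-- The `q`-Vandermonde convolution. -/
lemma qBinom_add_left {q : ℂ} (hq : notRootOfUnity q) (m n k : ℕ) :
    qBinom q (m + n) k
      = ∑ p ∈ antidiagonal k, qBinom q m p.1 * qBinom q n p.2 * q ^ ((m - p.1) * p.2) := by
  induction m generalizing k with
  | zero =>
    cases k with
    | zero => simp [qBinom_zero_right hq]
    | succ k =>
      rw [Nat.sum_antidiagonal_succ, sum_eq_zero]
      · simp [qBinom_zero_right hq]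
      · intro p _
        simp [qBinom_eq_zero]
  | succ m ih =>
    cases k with
    | zero => simp [qBinom_zero_right hq]
    | succ k =>
      rw [show m + 1 + n = m + n + 1 by ring, qBinom_succ_succ hq, ih, ih,
        Nat.sum_antidiagonal_succ, Nat.sum_antidiagonal_succ, mul_add, mul_sum,
        add_left_comm, ← sum_add_distrib]
      congr 1
      · simp only [qBinom_zero_right hq, Nat.sub_zero]
        ring
      · refine sum_congr rfl fun p hp => ?_
        rw [qBinom_succ_succ hq, ← mem_antidiagonal.1 hp, Nat.add_sub_add_right]
        rcases lt_or_ge p.1 m with h | h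
        · rw [show m - p.1 = (m - (p.1 + 1)) + 1 by lia]
          ring
        · rw [qBinom_eq_zero q (show m < p.1 + 1 by lia)]
          ring

/-- Multiplication by `q ^ m` on sequences. -/
noncomputable def qMul (q : ℂ) : Module.End ℂ (ℕ → ℂ) :=
  LinearMap.mulLeft ℂ (fun m => q ^ m)

/-- The operator `q ^ m + s * (shift)` on sequences. -/
noncomputable def qShift (q s : ℂ) : Module.End ℂ (ℕ → ℂ) :=
  qMul q + s • LinearMap.funLeft ℂ ℂ Nat.succ

@[simp] lemma qMul_apply (q : ℂ) (h : ℕ → ℂ) (m : ℕ) : qMul q h m = q ^ m * h m := rfl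

@[simp] lemma qShift_apply (q s : ℂ) (h : ℕ → ℂ) (m : ℕ) :
    qShift q s h m = q ^ m * h m + s * h (m + 1) := rfl

lemma qMul_inv_pow_apply (q : ℂ) (w : ℕ) (h : ℕ → ℂ) (m : ℕ) :
    (qMul q⁻¹ ^ w) h m = (q ^ (w * m))⁻¹ * h m := by
  induction w generalizing h with
  | zero => simp
  | succ w ih =>
    rw [pow_succ, Module.End.mul_apply, ih, qMul_apply, inv_pow, add_mul, pow_add, mul_inv,
      one_mul, mul_assoc]

lemma qShift_mul_qMul_inv {q : ℂ} (hq : q ≠ 0) (s : ℂ) :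
    q • (qShift q s * qMul q⁻¹) = qMul q⁻¹ * qShift q s + (q - 1) • 1 := by
  ext h m
  simp [pow_succ]
  field_simp
  ring

/-- Finite `q`-binomial theorem for the operators `qShift`. -/
lemma qShift_pow_apply {q : ℂ} (hq : notRootOfUnity q) (s : ℂ) (N : ℕ) (h : ℕ → ℂ) (m : ℕ) :
    (qShift q s ^ N) h m
      = ∑ p ∈ antidiagonal N, qBinom q N p.1 * (s ^ p.1 * q ^ (p.2 * m) * h (p.1 + m)) := by
  induction N generalizing h with
  | zero => simp [qBinom_zero_right hq]
  | succ N ih =>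
    rw [pow_succ, Module.End.mul_apply, ih, sum_qBinom_succ hq N
      (fun x y => s ^ x * q ^ (y * m) * h (x + m))]
    refine sum_congr rfl fun p _ => ?_
    rw [qShift_apply, show p.1 + m + 1 = p.1 + 1 + m by ring]
    ring

lemma qShift_pow_congr {q : ℂ} (hq : notRootOfUnity q) (s : ℂ) {N : ℕ} {h h' : ℕ → ℂ}
    (H : ∀ m ≤ N, h m = h' m) : (qShift q s ^ N) h 0 = (qShift q s ^ N) h' 0 := by
  rw [qShift_pow_apply hq, qShift_pow_apply hq]
  refine sum_congr rfl fun p hp => ?_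
  rw [add_zero, H p.1 (by have := mem_antidiagonal.1 hp; lia)]

lemma qShift_pow_succ_mul_qMul_inv {q : ℂ} (hq : q ≠ 0) (s : ℂ) (c : ℕ) :
    q ^ (c + 1) • (qShift q s ^ (c + 1) * qMul q⁻¹)
      = qMul q⁻¹ * qShift q s ^ (c + 1) + (q ^ (c + 1) - 1) • qShift q s ^ c := by
  induction c with
  | zero => simpa using qShift_mul_qMul_inv hq s
  | succ c ih =>
    have key : q ^ (c + 1 + 1) • (qShift q s ^ (c + 1 + 1) * qMul q⁻¹)
        = q • (qShift q s * (q ^ (c + 1) • (qShift q s ^ (c + 1) * qMul q⁻¹))) := by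
      rw [mul_smul_comm, smul_smul, ← mul_assoc, ← pow_succ', ← pow_succ']
    rw [key, ih, mul_add, smul_add, ← mul_assoc, ← smul_mul_assoc, qShift_mul_qMul_inv hq,
      add_mul, mul_assoc, ← pow_succ', smul_mul_assoc, one_mul, mul_smul_comm, ← pow_succ',
      smul_smul, add_assoc, ← add_smul]
    congr 2
    ring

lemma qShift_succ_pow_apply (q s t : ℂ) (b : ℕ) (f : ℕ → ℂ) :
    (qShift q (q * t) ^ (b + 1)) f
      = qShift q s ((qShift q (q * t) ^ b) f)
        + ((q * t - s) * q ^ b) • (qShift q t ^ b) (fun m => f (m + 1)) := by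
  have key : ∀ (b : ℕ) (f : ℕ → ℂ) (m : ℕ), (qShift q (q * t) ^ b) f (m + 1)
      = q ^ b * (qShift q t ^ b) (fun m => f (m + 1)) m := by
    intro b
    induction b with
    | zero => simp
    | succ b ih =>
      intro f m
      rw [pow_succ', Module.End.mul_apply, qShift_apply, ih, ih, pow_succ' (qShift q t),
        Module.End.mul_apply, qShift_apply]
      ring
  ext m
  rw [pow_succ', Module.End.mul_apply]
  simp only [qShift_apply, Pi.add_apply, Pi.smul_apply, smul_eq_mul, key]
  ring

lemma qShift_interchange {q : ℂ} (hq : q ≠ 0) (h f : ℕ → ℂ) (a b c d : ℕ)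
    (H : ∀ k N N', N + k = a + c → N' + k = b + d →
      (qShift q 1 ^ N) h 0 = (qShift q 1 ^ N') (fun m => f (k + m)) 0) :
    q ^ (b * c) * (qShift q 1 ^ c) ((qMul q⁻¹ ^ b) ((qShift q 1 ^ a) h)) 0
      = (qShift q 1 ^ d) ((qShift q (q ^ c) ^ b) f) 0 := by
  induction b generalizing c d f with
  | zero =>
    have := H 0 (c + a) d (by ring) (by ring)
    simpa [pow_add] using this
  | succ b ih =>
    have ih₁ := ih f c (d + 1) fun k N N' h₁ h₂ => H k N N' h₁ (by lia)
    rw [pow_succ (qShift q 1) d, Module.End.mul_apply] at ih₁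
    cases c with
    | zero =>
      have e := qShift_succ_pow_apply q 1 q⁻¹ b f
      rw [mul_inv_cancel₀ hq, sub_self, zero_mul, zero_smul, add_zero] at e
      simp only [pow_zero] at ih₁ ⊢
      rw [e, ← ih₁]
      simp [pow_succ']
    | succ c =>
      have ih₂ := ih (fun m => f (m + 1)) c d fun k N N' h₁ h₂ => by
        rw [H (k + 1) N N' (by lia) (by lia)]
        simp only [add_right_comm]
      have e₁ := congr_fun (LinearMap.congr_fun (qShift_pow_succ_mul_qMul_inv hq 1 c)
        ((qMul q⁻¹ ^ b) ((qShift q 1 ^ a) h))) 0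
      simp only [LinearMap.smul_apply, LinearMap.add_apply, Module.End.mul_apply, Pi.smul_apply,
        Pi.add_apply, smul_eq_mul, qMul_apply, pow_zero, one_mul] at e₁
      rw [pow_succ' q c, qShift_succ_pow_apply q 1, map_add, map_smul, Pi.add_apply,
        Pi.smul_apply, ← pow_succ' q c, ← ih₁, ← ih₂,
        pow_succ' (qMul _), Module.End.mul_apply, add_mul, pow_add, mul_assoc, one_mul, e₁,
        smul_eq_mul]
      ring

lemma sum_antidiagonal_assoc {M : Type*} [AddCommMonoid M] (n : ℕ) (F : ℕ → ℕ → ℕ → M) :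
    ∑ p ∈ antidiagonal n, ∑ r ∈ antidiagonal p.2, F p.1 r.1 r.2
      = ∑ p ∈ antidiagonal n, ∑ r ∈ antidiagonal p.1, F r.1 r.2 p.2 := by
  rw [sum_sigma', sum_sigma']
  refine sum_nbij' (fun x => ⟨(x.1.1 + x.2.1, x.2.2), (x.1.1, x.2.1)⟩)
    (fun x => ⟨(x.2.1, x.2.2 + x.1.2), (x.2.2, x.1.2)⟩) ?_ ?_ ?_ ?_ ?_ <;>
  · rintro ⟨⟨a, b⟩, c, d⟩ hx
    simp only [mem_sigma, HasAntidiagonal.mem_antidiagonal] at hx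
    obtain ⟨h₁, h₂⟩ := hx
    subst h₂
    subst h₁
    simp [add_assoc]

lemma sum_qBinom_mul_qBinom_sub {q : ℂ} (hq : notRootOfUnity q) (g β b : ℕ) (W : ℕ → ℂ) :
    ∑ x ∈ range (b + 1), qBinom q g x * qBinom q (β + g - x) (b - x) * W x
      = ∑ p ∈ antidiagonal b, qBinom q g p.1 * qBinom q β p.2 * q ^ ((g - p.1) * p.2)
          * ∑ r ∈ antidiagonal p.1, qBinom q p.1 r.1 * W r.1 := by
  rw [← Nat.sum_antidiagonal_eq_sum_range_succ
    (fun x s => qBinom q g x * qBinom q (β + g - x) s * W x)]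
  have key := sum_antidiagonal_assoc b (fun x y c =>
    qBinom q g x * qBinom q (g - x) y * qBinom q β c * q ^ ((g - x - y) * c) * W x)
  refine Eq.trans (sum_congr rfl fun p _ => ?_) (key.trans ?_)
  · rcases le_or_gt p.1 g with h | h
    · rw [show β + g - p.1 = (g - p.1) + β by lia, qBinom_add_left hq, mul_sum, sum_mul]
      exact sum_congr rfl fun r _ => by ring
    · simp [qBinom_eq_zero q h]
  · refine sum_congr rfl fun p _ => ?_
    rw [mul_sum]
    refine sum_congr rfl fun r hr => ?_
    rw [← qBinom_mul_qBinom hq, mem_antidiagonal.1 hr, Nat.sub_sub, mem_antidiagonal.1 hr]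
    ring

lemma sum_qBinom_mul_qBinom_add {q : ℂ} (hq : notRootOfUnity q) (g β b : ℕ) (W : ℕ → ℂ) :
    ∑ x ∈ range (β + 1), qBinom q β x * qBinom q (x + g) b * W x
      = ∑ p ∈ antidiagonal b, qBinom q g p.1 * qBinom q β p.2 * q ^ ((g - p.1) * p.2)
          * ∑ r ∈ antidiagonal (β - p.2), qBinom q (β - p.2) r.1 * W (p.2 + r.1) := by
  have key (c : ℕ) : ∑ x ∈ range (β + 1), qBinom q β x * qBinom q x c * W x
      = qBinom q β c * ∑ r ∈ antidiagonal (β - c), qBinom q (β - c) r.1 * W (c + r.1) := by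
    rcases le_or_gt c β with h | h
    · obtain ⟨w, rfl⟩ := Nat.exists_eq_add_of_le h
      rw [add_assoc, sum_range_add, sum_eq_zero, zero_add, Nat.add_sub_cancel_left,
        Nat.sum_antidiagonal_eq_sum_range_succ (fun x _ => qBinom q w x * W (c + x)), mul_sum]
      · refine sum_congr rfl fun x _ => ?_
        rw [qBinom_mul_qBinom hq, Nat.add_sub_cancel_left]
        ring
      · intro x hx
        rw [qBinom_eq_zero q (mem_range.1 hx)]
        ring
    · rw [qBinom_eq_zero q h, zero_mul, sum_eq_zero]
      intro x hx
      rw [qBinom_eq_zero q (show x < c by have := mem_range.1 hx; lia)]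
      ring
  simp_rw [add_comm _ g, qBinom_add_left hq, mul_sum, sum_mul]
  rw [sum_comm]
  refine sum_congr rfl fun p _ => ?_
  rw [← mul_sum, mul_right_comm (qBinom q g _), mul_assoc, ← key, mul_sum]
  exact sum_congr rfl fun x _ => by ring

/-- The `q`-weight `q ^ φ(β - x, x) ∏ᵢ binom(βᵢ, xᵢ)_q`. -/
noncomputable def qMultinom (q : ℂ) {n : ℕ} (β x : Fin n → ℕ) : ℂ :=
  q ^ (∑ i, ∑ j, if i < j then (β i - x i) * x j else 0) * ∏ i, qBinom q (β i) (x i)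

lemma qMultinom_zero (q : ℂ) (β x : Fin 0 → ℕ) : qMultinom q β x = 1 := by
  simp [qMultinom]

lemma qMultinom_cons (q : ℂ) {n : ℕ} (β₀ x₀ : ℕ) (β x : Fin n → ℕ) :
    qMultinom q (Fin.cons β₀ β : Fin (n + 1) → ℕ) (Fin.cons x₀ x : Fin (n + 1) → ℕ)
      = qBinom q β₀ x₀ * q ^ ((β₀ - x₀) * ∑ i, x i) * qMultinom q β x := by
  simp only [qMultinom, Fin.sum_univ_succ, Fin.prod_univ_succ, Fin.cons_zero, Fin.cons_succ,
    Fin.succ_lt_succ_iff, Fin.succ_pos, if_true, Fin.not_lt_zero, if_false, zero_add,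
    ← mul_sum, pow_add]
  ring

lemma qMultinom_eq_zero (q : ℂ) {n : ℕ} {β x : Fin n → ℕ} (h : ¬ x ≤ β) :
    qMultinom q β x = 0 := by
  obtain ⟨i, hi⟩ := not_forall.1 h
  rw [qMultinom, prod_eq_zero (mem_univ i) (qBinom_eq_zero q (not_le.1 hi)), mul_zero]

lemma sum_Iic_cons {M : Type*} [AddCommMonoid M] {n : ℕ} (b₀ : ℕ) (b : Fin n → ℕ)
    (F : (Fin (n + 1) → ℕ) → M) :
    ∑ x ∈ Iic (Fin.cons b₀ b : Fin (n + 1) → ℕ), F x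
      = ∑ x ∈ Iic b, ∑ x₀ ∈ range (b₀ + 1), F (Fin.cons x₀ x) := by
  rw [sum_sigma']
  refine sum_nbij' (fun x => ⟨Fin.tail x, x 0⟩) (fun p => Fin.cons p.2 p.1) ?_ ?_ ?_ ?_ ?_
  · intro x hx
    have hx := mem_Iic.1 hx
    exact mem_sigma.2 ⟨mem_Iic.2 fun i => hx i.succ, mem_range_succ_iff.2 (hx 0)⟩
  · rintro ⟨x, x₀⟩ hx
    obtain ⟨h₁, h₂⟩ := mem_sigma.1 hx
    refine mem_Iic.2 fun i => ?_
    cases i using Fin.cases with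
    | zero => exact mem_range_succ_iff.1 h₂
    | succ i => exact mem_Iic.1 h₁ i
  · intro x _
    exact Fin.cons_self_tail x
  · rintro ⟨x, x₀⟩ _
    rfl
  · intro x _
    simp

/-- A vector summation identity follows from the family of its scalar counterparts. -/
lemma qMultinom_sum_eq {q : ℂ} (hq0 : q ≠ 0) (hq : notRootOfUnity q) {n : ℕ}
    (g β b : Fin n → ℕ) (h f : ℕ → ℂ)
    (H : ∀ J E C, J + C = ∑ i, b i → E + C = ∑ i, β i → J ≤ ∑ i, g i →
      (qShift q 1 ^ J) h 0 = (qShift q 1 ^ E) (fun m => f (C + m)) 0) :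
    ∑ x ∈ Iic b, qMultinom q g x * qMultinom q (β + g - x) (b - x) * h (∑ i, x i)
      = ∑ x ∈ Iic β, qMultinom q β x * qMultinom q (x + g) b * f (∑ i, x i) := by
  induction n generalizing h f with
  | zero =>
    have := H 0 0 0 (by simp) (by simp) (by simp)
    have hb : Iic b = {0} := by ext x; simp [Subsingleton.elim x b, Subsingleton.elim 0 b]
    have hβ : Iic β = {0} := by ext x; simp [Subsingleton.elim x β, Subsingleton.elim 0 β]
    simpa [hb, hβ, qMultinom_zero] using this
  | succ n ih =>
    obtain ⟨g₀, g, rfl⟩ : ∃ x₀ x, g = Fin.cons x₀ x := ⟨_, _, (Fin.cons_self_tail g).symm⟩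
    obtain ⟨β₀, β, rfl⟩ : ∃ x₀ x, β = Fin.cons x₀ x := ⟨_, _, (Fin.cons_self_tail β).symm⟩
    obtain ⟨b₀, b, rfl⟩ : ∃ x₀ x, b = Fin.cons x₀ x := ⟨_, _, (Fin.cons_self_tail b).symm⟩
    simp only [Fin.sum_cons] at H
    set B := ∑ i, b i with hB
    have add_cons (x₀ y₀ : ℕ) (x y : Fin n → ℕ) : (Fin.cons x₀ x + Fin.cons y₀ y : Fin (n + 1) → ℕ)
        = Fin.cons (x₀ + y₀) (x + y) := by
      ext i; cases i using Fin.cases <;> simp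
    have sub_cons (x₀ y₀ : ℕ) (x y : Fin n → ℕ) : (Fin.cons x₀ x - Fin.cons y₀ y : Fin (n + 1) → ℕ)
        = Fin.cons (x₀ - y₀) (x - y) := by
      ext i; cases i using Fin.cases <;> simp
    set h' : ℕ → ℂ := fun m => ∑ x ∈ range (b₀ + 1), qBinom q g₀ x * qBinom q (β₀ + g₀ - x) (b₀ - x)
      * (q ^ ((g₀ - x) * m) * q ^ ((β₀ + g₀ - b₀) * (B - m)) * h (x + m)) with h'_def
    set f' : ℕ → ℂ := fun m => ∑ x ∈ range (β₀ + 1), qBinom q β₀ x * qBinom q (x + g₀) b₀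
      * (q ^ ((β₀ - x) * m) * q ^ ((x + g₀ - b₀) * B) * f (x + m)) with f'_def
    have step := ih g β b h' f' ?_
    · rw [sum_Iic_cons, sum_Iic_cons]
      simp only [add_cons, sub_cons, qMultinom_cons, Fin.sum_cons]
      refine Eq.trans (sum_congr rfl fun x hx => ?_)
        (step.trans (sum_congr rfl fun x hx => ?_).symm)
      · rw [h'_def, mul_sum]
        refine sum_congr rfl fun x₀ hx₀ => ?_
        have h₀ := mem_range_succ_iff.1 hx₀
        have hs : ∑ i, (b - x) i = B - ∑ i, x i := by
          simp only [Pi.sub_apply, hB]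
          exact sum_tsub_distrib _ fun i _ => mem_Iic.1 hx i
        rw [hs, show β₀ + g₀ - x₀ - (b₀ - x₀) = β₀ + g₀ - b₀ by lia]
        ring
      · rw [f'_def, mul_sum]
        refine sum_congr rfl fun x₀ hx₀ => ?_
        rw [← hB]
        ring
    · intro J E C hJ hE hJg
      set K : ℕ × ℕ → ℂ := fun p => qBinom q g₀ p.1 * qBinom q β₀ p.2 * q ^ ((g₀ - p.1) * p.2)
        * q ^ ((g₀ - p.1) * B) * q ^ ((β₀ - p.2) * C) with hK
      have hh' : (qShift q 1 ^ J) h' 0 = (qShift q 1 ^ J) (∑ p ∈ antidiagonal b₀,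
          (K p * q ^ ((β₀ - p.2) * J)) • (qMul q⁻¹ ^ (β₀ - p.2)) ((qShift q 1 ^ p.1) h)) 0 := by
        refine qShift_pow_congr hq 1 fun m hm => ?_
        obtain ⟨s, rfl⟩ := Nat.exists_eq_add_of_le hm
        simp only [h'_def, Finset.sum_apply, Pi.smul_apply, smul_eq_mul, qMul_inv_pow_apply,
          qShift_pow_apply hq]
        rw [sum_qBinom_mul_qBinom_sub hq g₀ β₀ b₀
          (fun x => q ^ ((g₀ - x) * m) * q ^ ((β₀ + g₀ - b₀) * (B - m)) * h (x + m))]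
        refine sum_congr rfl fun p hp => ?_
        have hp := HasAntidiagonal.mem_antidiagonal.1 hp
        rcases lt_or_ge g₀ p.1 with h₁ | h₁
        · simp [hK, qBinom_eq_zero q h₁]
        rcases lt_or_ge β₀ p.2 with h₂ | h₂
        · simp [hK, qBinom_eq_zero q h₂]
        simp only [hK, mul_sum]
        refine sum_congr rfl fun r hr => ?_
        have hr := HasAntidiagonal.mem_antidiagonal.1 hr
        obtain ⟨u, hu⟩ := Nat.exists_eq_add_of_le h₁
        obtain ⟨w, hw⟩ := Nat.exists_eq_add_of_le h₂
        rw [show g₀ - p.1 = u by lia, show β₀ - p.2 = w by lia, show β₀ + g₀ - b₀ = u + w by lia,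
          show g₀ - r.1 = u + r.2 by lia, show B = m + s + C from hB.trans hJ.symm,
          show m + s + C - m = s + C by lia]
        have : q ^ (w * m) ≠ 0 := pow_ne_zero _ hq0
        field_simp
        ring
      have hf' : (fun m => f' (C + m)) = ∑ p ∈ antidiagonal b₀,
          K p • (qShift q (q ^ J) ^ (β₀ - p.2)) (fun m => f (p.2 + C + m)) := by
        ext m
        simp only [f'_def, Finset.sum_apply, Pi.smul_apply, smul_eq_mul, qShift_pow_apply hq]
        rw [sum_qBinom_mul_qBinom_add hq g₀ β₀ b₀
          (fun x => q ^ ((β₀ - x) * (C + m)) * q ^ ((x + g₀ - b₀) * B) * f (x + (C + m)))]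
        refine sum_congr rfl fun p hp => ?_
        have hp := HasAntidiagonal.mem_antidiagonal.1 hp
        rcases lt_or_ge g₀ p.1 with h₁ | h₁
        · simp [hK, qBinom_eq_zero q h₁]
        rcases lt_or_ge β₀ p.2 with h₂ | h₂
        · simp [hK, qBinom_eq_zero q h₂]
        simp only [hK, mul_sum]
        refine sum_congr rfl fun r hr => ?_
        have hr := HasAntidiagonal.mem_antidiagonal.1 hr
        obtain ⟨u, hu⟩ := Nat.exists_eq_add_of_le h₁
        rw [show g₀ - p.1 = u by lia, show β₀ - (p.2 + r.1) = r.2 by lia,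
          show p.2 + r.1 + g₀ - b₀ = u + r.1 by lia, ← hr,
          show B = J + C from hB.trans hJ.symm,
          show p.2 + r.1 + (C + m) = p.2 + C + (r.1 + m) by ring]
        ring
      rw [hh', hf', map_sum, map_sum, Finset.sum_apply, Finset.sum_apply]
      refine sum_congr rfl fun p hp => ?_
      have hp := HasAntidiagonal.mem_antidiagonal.1 hp
      rcases lt_or_ge g₀ p.1 with h₁ | h₁
      · simp [hK, qBinom_eq_zero q h₁]
      rcases lt_or_ge β₀ p.2 with h₂ | h₂
      · simp [hK, qBinom_eq_zero q h₂]
      rw [map_smul, map_smul, Pi.smul_apply, Pi.smul_apply, smul_eq_mul, smul_eq_mul, mul_assoc,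
        qShift_interchange hq0 h (fun m => f (p.2 + C + m))]
      intro k N N' hN hN'
      rw [H N N' (p.2 + C + k) (by lia) (by lia) (by lia)]
      simp only [add_assoc]

/-- The functional `h ↦ ∑ x + y = J, binom(J,x)_q (r;q)_y r ^ x h(x)`, see `qSum_apply`. -/
noncomputable def qSum (q r : ℂ) : ℕ → (ℕ → ℂ) →ₗ[ℂ] ℂ
  | 0 => LinearMap.proj 0
  | J + 1 => qSum q r J ∘ₗ (qShift q r - (r * q ^ J) • 1)

lemma qSum_succ (q r : ℂ) (J : ℕ) (h : ℕ → ℂ) :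
    qSum q r (J + 1) h = qSum q r J (qShift q r h - (r * q ^ J) • h) := rfl

lemma qSum_apply {q : ℂ} (hq : notRootOfUnity q) (r : ℂ) (J : ℕ) (h : ℕ → ℂ) :
    qSum q r J h = ∑ p ∈ antidiagonal J, qBinom q J p.1 * (qPoch q r p.2 * r ^ p.1 * h p.1) := by
  induction J generalizing h with
  | zero => simp [qSum, qBinom_zero_right hq, qPoch_zero]
  | succ J ih =>
    rw [qSum_succ, ih, sum_qBinom_succ hq J (fun x y => qPoch q r y * r ^ x * h x)]
    refine sum_congr rfl fun p hp => ?_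
    rw [Pi.sub_apply, Pi.smul_apply, qShift_apply, qPoch_succ, smul_eq_mul,
      ← HasAntidiagonal.mem_antidiagonal.1 hp]
    ring

lemma qSum_qMul_inv {q : ℂ} (hq : q ≠ 0) (r : ℂ) (J : ℕ) (h : ℕ → ℂ) :
    q ^ J * qSum q r J (qMul q⁻¹ (qShift q r h - r • h))
      = qSum q r (J + 1) h + (q ^ J - 1) * qSum q r J h := by
  induction J generalizing h with
  | zero => simp [qSum]
  | succ J ih =>
    have key : q • (qShift q r (qMul q⁻¹ (qShift q r h - r • h))
          - (r * q ^ J) • qMul q⁻¹ (qShift q r h - r • h))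
        = qMul q⁻¹ (qShift q r (qShift q r h - (r * q ^ (J + 1)) • h)
            - r • (qShift q r h - (r * q ^ (J + 1)) • h))
          + (q - 1) • (qShift q r h - r • h) := by
      have e := LinearMap.congr_fun (qShift_mul_qMul_inv hq r) (qShift q r h - r • h)
      simp only [LinearMap.smul_apply, LinearMap.add_apply, Module.End.mul_apply,
        Module.End.one_apply] at e
      rw [smul_sub, e]
      simp only [map_sub, map_smul]
      module
    rw [qSum_succ, pow_succ, mul_assoc, ← smul_eq_mul (a := q), ← map_smul, key, map_add,
      mul_add, ih, qSum_succ _ _ (J + 1), qSum_succ _ _ J h]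
    simp only [map_sub, map_smul, smul_eq_mul]
    ring

lemma symm_of_recurrence {q : ℂ} (hq : q ≠ 0) (F : ℕ → ℕ → ℂ)
    (H : ∀ J E, q ^ J * F J (E + 1) = q ^ E * F (J + 1) E + (q ^ J - q ^ E) * F J E) (J E : ℕ) :
    F J E = F E J := by
  obtain ⟨N, hN⟩ : ∃ N, J + E = N := ⟨_, rfl⟩
  induction N generalizing J E with
  | zero =>
    obtain ⟨rfl, rfl⟩ : J = 0 ∧ E = 0 := by lia
    rfl
  | succ N ih =>
    have key : ∀ J E, J + E = N + 1 →
        q ^ (J * E) * (F J E - F E J) = F 0 (N + 1) - F (N + 1) 0 := by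
      intro J
      induction J with
      | zero => intro E hE; simp at hE; simp [hE]
      | succ J ihJ =>
        intro E hE
        rw [← ihJ (E + 1) (by lia)]
        have h₁ := H J E
        have h₂ := H E J
        rw [ih J E (by lia)] at h₁
        rw [add_one_mul, mul_add_one, pow_add, pow_add]
        linear_combination (-q ^ (J * E)) * (h₁ + h₂)
    have h₀ := key (N + 1) 0 rfl
    have h₁ := key J E hN
    simp only [mul_zero, pow_zero, one_mul] at h₀
    have h₂ : F 0 (N + 1) - F (N + 1) 0 = 0 := by linear_combination (-1 / 2 : ℂ) * h₀
    rw [h₂] at h₁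
    exact sub_eq_zero.1 ((mul_eq_zero.1 h₁).resolve_left (pow_ne_zero _ hq))

lemma qSum_symm {q : ℂ} (hq : q ≠ 0) (u r t : ℂ) (hd : ∀ m, qPoch q (u * r * t) m ≠ 0)
    (C K J E : ℕ) :
    qSum q r J (fun x => qPoch q (u * r) (C + E) * qPoch q (r * t) (K + E) * qPoch q u (C + x)
        * qPoch q t (K + x) / qPoch q (u * r * t) (C + K + E + x))
      = qSum q r E (fun x => qPoch q (u * r) (C + J) * qPoch q (r * t) (K + J)
        * qPoch q u (C + x) * qPoch q t (K + x) / qPoch q (u * r * t) (C + K + J + x)) := by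
  refine symm_of_recurrence hq (fun J E => qSum q r J (fun x => qPoch q (u * r) (C + E)
    * qPoch q (r * t) (K + E) * qPoch q u (C + x) * qPoch q t (K + x)
    / qPoch q (u * r * t) (C + K + E + x))) (fun J E => ?_) J E
  set g : ℕ → ℂ := fun x => qPoch q (u * r) (C + E) * qPoch q (r * t) (K + E)
    * qPoch q u (C + x) * qPoch q t (K + x) / qPoch q (u * r * t) (C + K + E + x) with hg
  have key : (fun x => qPoch q (u * r) (C + (E + 1)) * qPoch q (r * t) (K + (E + 1))
        * qPoch q u (C + x) * qPoch q t (K + x) / qPoch q (u * r * t) (C + K + (E + 1) + x))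
      = q ^ E • qMul q⁻¹ (qShift q r g - r • g) + (1 - q ^ E) • g := by
    ext x
    have h₀ := hd (C + K + E + x)
    have h₁ := hd (C + K + E + x + 1)
    simp only [Pi.add_apply, Pi.smul_apply, Pi.sub_apply, qMul_apply, qShift_apply, smul_eq_mul,
      hg, ← add_assoc]
    rw [add_right_comm (C + K + E) 1 x]
    rw [qPoch_succ] at h₁ ⊢
    have h₂ := right_ne_zero_of_mul h₁
    simp only [qPoch_succ, inv_pow]
    field_simp
    ring
  rw [key, map_add, map_smul, map_smul, smul_eq_mul, smul_eq_mul]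
  linear_combination q ^ E * qSum_qMul_inv hq r J g

lemma qShift_pow_eq_qShift_pow {q : ℂ} (hq0 : q ≠ 0) (hq : notRootOfUnity q) (u r t : ℂ)
    (hd : ∀ m, qPoch q (u * r * t) m ≠ 0) (hur : ∀ m, qPoch q (u * r) m ≠ 0)
    {G B β J E C : ℕ} (hJ : J + C = B) (hE : E + C = β) (hG : J ≤ G) :
    (qShift q 1 ^ J) (fun x => t ^ x * qPoch q t (G - x) * (r * t) ^ (B - x) * qPoch q u (B - x)
        * qPoch q (r * t) (β + G - x - (B - x)) * qPoch q r x
        / qPoch q (u * r * t) (β + G - x)) 0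
      = (qShift q 1 ^ E) (fun x => qPoch q (r * t) G * r ^ (C + x) * qPoch q u (C + x)
        * qPoch q r (β - (C + x)) / qPoch q (u * r) β * t ^ B * qPoch q (u * r) B
        * qPoch q t (C + x + G - B) / qPoch q (u * r * t) (C + x + G)) 0 := by
  obtain ⟨K, rfl⟩ := Nat.exists_eq_add_of_le hG
  subst hJ hE
  have key := congr_arg (fun z => t ^ (J + C) * r ^ C / qPoch q (u * r) (C + E) * z)
    (qSum_symm hq0 u r t hd C K J E)
  simp only [qSum_apply hq, mul_sum] at key
  rw [qShift_pow_apply hq, qShift_pow_apply hq]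
  have h₀ := hur (C + E)
  refine Eq.trans ?_ (key.trans ?_)
  · rw [← Nat.sum_antidiagonal_swap]
    refine sum_congr rfl fun p hp => ?_
    have hp := HasAntidiagonal.mem_antidiagonal.1 hp
    have h₁ := hd (C + K + E + p.1)
    simp only [Prod.fst_swap, Prod.snd_swap, add_zero]
    rw [← hp, ← qBinom_symm, show p.1 + p.2 + K - p.2 = K + p.1 by lia,
      show p.1 + p.2 + C - p.2 = C + p.1 by lia,
      show E + C + (p.1 + p.2 + K) - p.2 = C + K + E + p.1 by lia,
      show C + K + E + p.1 - (C + p.1) = K + E by lia]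
    generalize qPoch q (u * r) (C + E) = P at h₀ ⊢
    field_simp
    ring
  · refine sum_congr rfl fun p hp => ?_
    have hp := HasAntidiagonal.mem_antidiagonal.1 hp
    have h₁ := hd (C + K + J + p.1)
    simp only [add_zero]
    rw [show E + C - (C + p.1) = p.2 by lia, show C + p.1 + (J + K) - (J + C) = K + p.1 by lia,
      show C + p.1 + (J + K) = C + K + J + p.1 by lia, add_comm E C, add_comm J K, add_comm J C]
    field_simp
    ring

lemma Phi_eq (n : ℕ) (q lam mu : ℂ) (γ β : Fin n → ℕ) :
    Phi n q lam mu γ β = qMultinom q β γ * ((mu / lam) ^ (∑ i, γ i) * qPoch q lam (∑ i, γ i)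
      * qPoch q (mu / lam) ((∑ i, β i) - ∑ i, γ i) / qPoch q mu (∑ i, β i)) := by
  by_cases h : γ ≤ β
  · have e : phi (fun i => (β i : ℤ) - (γ i : ℤ)) (fun i => (γ i : ℤ))
        = ((∑ i, ∑ j, if i < j then (β i - γ i) * γ j else 0 : ℕ) : ℤ) := by
      simp only [phi, Nat.cast_sum]
      refine sum_congr rfl fun i _ => sum_congr rfl fun j _ => ?_
      split_ifs
      · rw [Nat.cast_mul, Nat.cast_sub (h i)]
      · rfl
    rw [Phi, if_pos h, e, zpow_natCast, qMultinom]
    ring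
  · rw [Phi, if_neg h, qMultinom_eq_zero q h, zero_mul]

lemma Phi_eq_zero (n : ℕ) (q lam mu : ℂ) {γ β : Fin n → ℕ} (h : ¬ γ ≤ β) :
    Phi n q lam mu γ β = 0 := if_neg h

/-- Trinomial revision for vectors. -/
lemma qMultinom_mul_qMultinom {q : ℂ} (hq : notRootOfUnity q) {n : ℕ} (a g x : Fin n → ℕ) :
    qMultinom q (a + g) (a + x) * qMultinom q (a + x) a
      = qMultinom q (a + g) a * qMultinom q g x := by
  by_cases h : x ≤ g
  · have e : ∀ i, qBinom q ((a + g) i) ((a + x) i) * qBinom q ((a + x) i) (a i)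
        = qBinom q ((a + g) i) (a i) * qBinom q (g i) (x i) := fun i => by
      simpa using qBinom_mul_qBinom hq (a i + g i) (a i) (x i)
    simp only [qMultinom]
    rw [mul_mul_mul_comm (q ^ _) (∏ _, _), mul_mul_mul_comm (q ^ _) (∏ _, _),
      ← prod_mul_distrib, ← prod_mul_distrib,
      prod_congr rfl fun i _ => e i, ← pow_add, ← pow_add, ← sum_add_distrib,
      ← sum_add_distrib]
    congr 2
    refine sum_congr rfl fun i _ => ?_
    rw [← sum_add_distrib, ← sum_add_distrib]
    refine sum_congr rfl fun j _ => ?_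
    obtain ⟨y, hy⟩ := Nat.exists_eq_add_of_le (h i)
    split_ifs
    · simp only [Pi.add_apply, hy, Nat.add_sub_cancel_left, Nat.add_sub_add_left]
      ring
    · rfl
  · rw [qMultinom_eq_zero q h, qMultinom_eq_zero q (mt (fun h' i => ?_) h), zero_mul, mul_zero]
    simpa using h' i

/-- The Yang–Baxter equation in terms of matrix coefficients. -/
lemma sum_Phi_eq {q ν₁ ν₂ ν₃ : ℂ} (hq0 : q ≠ 0) (hq : notRootOfUnity q) (h1 : ν₁ ≠ 0)
    (h2 : ν₂ ≠ 0) (h3 : ∀ m, qPoch q ν₂ m ≠ 0) (h4 : ∀ m, qPoch q ν₃ m ≠ 0) {n : ℕ}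
    (a b β γ : Fin n → ℕ) :
    ∑ x ∈ Iic b, Phi n q ν₂ ν₃ (a + x) γ * Phi n q ν₁ ν₃ (b - x) (β + γ - (a + x))
        * Phi n q ν₁ ν₂ a (a + x)
      = ∑ x ∈ Iic β, Phi n q ν₁ ν₂ x β * Phi n q ν₁ ν₃ a γ * Phi n q ν₂ ν₃ b (x + γ - a) := by
  by_cases hγ : a ≤ γ
  · obtain ⟨g, rfl⟩ := exists_add_of_le hγ
    obtain ⟨r, rfl⟩ : ∃ r, ν₂ = ν₁ * r := ⟨ν₂ / ν₁, by field_simp⟩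
    obtain ⟨t, rfl⟩ : ∃ t, ν₃ = ν₁ * r * t := ⟨ν₃ / (ν₁ * r), (mul_div_cancel₀ _ h2).symm⟩
    have hr0 := right_ne_zero_of_mul h2
    have key := qMultinom_sum_eq hq0 hq g β b _
      (fun x => qPoch q (r * t) (∑ i, g i) * r ^ x * qPoch q ν₁ x * qPoch q r (∑ i, β i - x)
        / qPoch q (ν₁ * r) (∑ i, β i) * t ^ (∑ i, b i) * qPoch q (ν₁ * r) (∑ i, b i)
        * qPoch q t (x + ∑ i, g i - ∑ i, b i) / qPoch q (ν₁ * r * t) (x + ∑ i, g i))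
      fun J E C hJ hE hG =>
      qShift_pow_eq_qShift_pow hq0 hq ν₁ r t h4 h3 hJ hE hG
    have key := congr_arg (fun z => qMultinom q (a + g) a * (r * t) ^ (∑ i, a i)
      * qPoch q ν₁ (∑ i, a i) / qPoch q (ν₁ * r * t) (∑ i, (a + g) i) * z) key
    simp only [mul_sum] at key
    have hr : ν₁ * r / ν₁ = r := by field_simp
    have ht : ν₁ * r * t / (ν₁ * r) = t := by field_simp
    have hrt : ν₁ * r * t / ν₁ = r * t := by field_simp
    simp only [Phi_eq, hr, ht, hrt]
    refine Eq.trans (sum_congr rfl fun x hx => ?_)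
      (key.trans (sum_congr rfl fun x hx => ?_))
    · by_cases hxg : x ≤ g
      · have hxb := mem_Iic.1 hx
        have e₁ : β + (a + g) - (a + x) = β + g - x := by
          ext i; simp only [Pi.add_apply, Pi.sub_apply]; lia
        have e₂ : ∑ i, (b - x) i = ∑ i, b i - ∑ i, x i := sum_tsub_distrib _ fun i _ => hxb i
        have e₃ : ∑ i, (β + g - x) i = ∑ i, β i + ∑ i, g i - ∑ i, x i := by
          rw [← sum_add_distrib]
          exact sum_tsub_distrib _ fun i _ => (hxg i).trans (Nat.le_add_left _ _)
        have e₄ : ∀ y : Fin n → ℕ, ∑ i, (a + y) i = ∑ i, a i + ∑ i, y i :=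
          fun y => sum_add_distrib
        have h₀ := h3 (∑ i, a i + ∑ i, x i)
        have e₅ := qMultinom_mul_qMultinom hq a g x
        rw [e₁, e₂, e₃, e₄, e₄, Nat.add_sub_add_left, Nat.add_sub_cancel_left]
        generalize ∑ i, a i = A at h₀ ⊢
        generalize ∑ i, b i = B
        generalize ∑ i, x i = X at h₀ ⊢
        generalize ∑ i, g i = G
        generalize ∑ i, β i = D
        generalize qPoch q (ν₁ * r) (A + X) = P at h₀ ⊢
        generalize qMultinom q (a + g) (a + x) = M₁ at e₅ ⊢
        generalize qMultinom q (a + x) a = M₂ at e₅ ⊢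
        have e₆ := mul_inv_cancel₀ h₀
        linear_combination t ^ (A + X) * qPoch q t (G - X) / qPoch q (ν₁ * r * t) (A + G)
          * (qMultinom q (β + g - x) (b - x) * (r * t) ^ (B - X) * qPoch q ν₁ (B - X)
            * qPoch q (r * t) (D + G - X - (B - X)) / qPoch q (ν₁ * r * t) (D + G - X))
          * (r ^ A * qPoch q ν₁ A * qPoch q r X)
          * (P * P⁻¹ * e₅ + qMultinom q (a + g) a * qMultinom q g x * e₆)
      · rw [qMultinom_eq_zero q hxg, qMultinom_eq_zero q (mt (fun h' i => ?_) hxg)]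
        · ring
        · simpa using h' i
    · have e₁ : x + (a + g) - a = x + g := by
        ext i; simp only [Pi.add_apply, Pi.sub_apply]; lia
      have e₂ : ∀ x y : Fin n → ℕ, ∑ i, (x + y) i = ∑ i, x i + ∑ i, y i :=
          fun x y => sum_add_distrib
      rw [e₁, e₂, e₂, Nat.add_sub_cancel_left]
      ring
  · rw [sum_eq_zero, sum_eq_zero]
    · intro x _
      rw [Phi_eq_zero _ _ _ _ hγ]
      ring
    · intro x _
      rw [Phi_eq_zero _ _ _ _ (mt (fun h' => le_trans ?_ h') hγ)]
      · ring
      · exact le_add_of_nonneg_right zero_le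

lemma sum_Iic_Phi_smul {n : ℕ} (q lam mu : ℂ) {β N : Fin n → ℕ} (h : β ≤ N)
    {M : Type*} [AddCommGroup M] [Module ℂ M] (F : (Fin n → ℕ) → M) :
    ∑ γ ∈ Iic N, Phi n q lam mu γ β • F γ = ∑ γ ∈ Iic β, Phi n q lam mu γ β • F γ := by
  refine (sum_subset (Iic_subset_Iic.2 h) fun γ _ hγ => ?_).symm
  rw [Phi_eq_zero n q lam mu (mt mem_Iic.2 hγ), zero_smul]

lemma S12_single {n : ℕ} (q lam mu : ℂ) (α β γ : LocalState n) :
    S12 n q lam mu (Finsupp.single (α, β, γ) 1)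
      = ∑ x ∈ Iic β, Phi n q lam mu x β • Finsupp.single (x, α + β - x, γ) 1 := by
  rw [← sum_Iic_Phi_smul q lam mu (le_add_of_nonneg_left zero_le : β ≤ α + β)]
  simp [S12]

lemma S13_single {n : ℕ} (q lam mu : ℂ) (α β γ : LocalState n) :
    S13 n q lam mu (Finsupp.single (α, β, γ) 1)
      = ∑ x ∈ Iic γ, Phi n q lam mu x γ • Finsupp.single (x, β, α + γ - x) 1 := by
  rw [← sum_Iic_Phi_smul q lam mu (le_add_of_nonneg_left zero_le : γ ≤ α + γ)]
  simp [S13]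

lemma S23_single {n : ℕ} (q lam mu : ℂ) (α β γ : LocalState n) :
    S23 n q lam mu (Finsupp.single (α, β, γ) 1)
      = ∑ x ∈ Iic γ, Phi n q lam mu x γ • Finsupp.single (α, x, β + γ - x) 1 := by
  rw [← sum_Iic_Phi_smul q lam mu (le_add_of_nonneg_left zero_le : γ ≤ β + γ)]
  simp [S23]

lemma S12_S13_S23_single {n : ℕ} (q ν₁ ν₂ ν₃ : ℂ) (α β γ : LocalState n) :
    S12 n q ν₁ ν₂ (S13 n q ν₁ ν₃ (S23 n q ν₂ ν₃ (Finsupp.single (α, β, γ) 1)))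
      = ∑ a ∈ Iic γ, ∑ b ∈ Iic (β + γ),
          (∑ x ∈ Iic b, Phi n q ν₂ ν₃ (a + x) γ * Phi n q ν₁ ν₃ (b - x) (β + γ - (a + x))
            * Phi n q ν₁ ν₂ a (a + x)) • Finsupp.single (a, b, α + β + γ - a - b) 1 := by
  simp only [S23_single, map_sum, map_smul, S13_single, S12_single, smul_sum, smul_smul, sum_smul]
  simp only [sum_sigma']
  refine sum_of_injOn (fun s => ⟨s.2.2, s.2.1 + (s.1 - s.2.2), s.1 - s.2.2⟩) ?_ ?_ ?_ ?_
  · rintro ⟨x, y, z⟩ h ⟨x', y', z'⟩ h' e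
    simp only [coe_sigma, mem_coe, mem_Iic, Set.mem_sigma_iff, Sigma.mk.injEq,
      heq_eq_eq] at h h' e
    obtain ⟨rfl, e₂, e₃⟩ := e
    have hx : x = x' := by rw [← tsub_add_cancel_of_le h.2.2, e₃, tsub_add_cancel_of_le h'.2.2]
    subst hx
    rw [add_right_cancel e₂]
  · rintro ⟨x, y, z⟩ h
    simp only [mem_coe, mem_sigma, mem_Iic] at h ⊢
    obtain ⟨h₁, h₂, h₃⟩ := h
    refine ⟨h₃.trans h₁, fun i => ?_, le_add_of_nonneg_left zero_le⟩
    have := h₁ i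
    have := h₂ i
    simp only [Pi.add_apply, Pi.sub_apply] at *
    lia
  · rintro ⟨a, b, x⟩ h h'
    simp only [mem_sigma, mem_Iic] at h
    by_cases h₁ : a + x ≤ γ
    · by_cases h₂ : b - x ≤ β + γ - (a + x)
      · refine absurd ⟨⟨a + x, b - x, a⟩, ?_, ?_⟩ h'
        · simp only [mem_coe, mem_sigma, mem_Iic]
          exact ⟨h₁, h₂, le_add_of_nonneg_right zero_le⟩
        · simp only [add_tsub_cancel_left, tsub_add_cancel_of_le h.2.2]
      · simp [Phi_eq_zero n q ν₁ ν₃ h₂]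
    · simp [Phi_eq_zero n q ν₂ ν₃ h₁]
  · rintro ⟨x, y, z⟩ h
    simp only [mem_sigma, mem_Iic] at h
    obtain ⟨h₁, h₂, h₃⟩ := h
    simp only [add_tsub_cancel_right, add_tsub_cancel_of_le h₃]
    have e₁ : y + x - z = y + (x - z) := add_tsub_assoc_of_le h₃ y
    have e₂ : α + (β + γ - x) - y = α + β + γ - z - (y + (x - z)) := by
      ext i
      have := h₁ i
      have := h₂ i
      have := h₃ i
      simp only [Pi.add_apply, Pi.sub_apply] at *
      lia
    rw [e₁, e₂]

lemma S23_S13_S12_single {n : ℕ} (q ν₁ ν₂ ν₃ : ℂ) (α β γ : LocalState n) :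
    S23 n q ν₂ ν₃ (S13 n q ν₁ ν₃ (S12 n q ν₁ ν₂ (Finsupp.single (α, β, γ) 1)))
      = ∑ a ∈ Iic γ, ∑ b ∈ Iic (β + γ),
          (∑ x ∈ Iic β, Phi n q ν₁ ν₂ x β * Phi n q ν₁ ν₃ a γ * Phi n q ν₂ ν₃ b (x + γ - a))
            • Finsupp.single (a, b, α + β + γ - a - b) 1 := by
  simp only [S12_single, map_sum, map_smul, S13_single, S23_single, sum_smul, mul_smul]
  rw [sum_congr rfl fun x _ => smul_sum, sum_comm]
  refine sum_congr rfl fun a ha => ?_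
  rw [sum_comm]
  refine sum_congr rfl fun x hx => ?_
  simp only [mem_Iic] at ha hx
  have hN : x + γ - a ≤ β + γ := tsub_le_self.trans (add_le_add_left hx γ)
  rw [← smul_sum, ← smul_sum, sum_Iic_Phi_smul q ν₂ ν₃ hN]
  have e : α + β - x + (x + γ - a) = α + β + γ - a := by
    ext i
    have := ha i
    have := hx i
    simp only [Pi.add_apply, Pi.sub_apply] at *
    lia
  rw [e]

/-- The Yang–Baxter equation for the stochastic R matrix of `U_q(A^{(1)}_n)`:
`S₁₂(ν₁,ν₂) S₁₃(ν₁,ν₃) S₂₃(ν₂,ν₃) = S₂₃(ν₂,ν₃) S₁₃(ν₁,ν₃) S₁₂(ν₁,ν₂)`. -/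
theorem yang_baxter (n : ℕ) (hn : 1 ≤ n) (q ν₁ ν₂ ν₃ : ℂ) (hq0 : q ≠ 0)
    (hq : notRootOfUnity q) (h1 : ν₁ ≠ 0) (h2 : ν₂ ≠ 0)
    (h3 : ∀ m : ℕ, 1 ≤ m → qPoch q ν₂ m ≠ 0)
    (h4 : ∀ m : ℕ, 1 ≤ m → qPoch q ν₃ m ≠ 0) :
    (S12 n q ν₁ ν₂) ∘ₗ (S13 n q ν₁ ν₃) ∘ₗ (S23 n q ν₂ ν₃)
      = (S23 n q ν₂ ν₃) ∘ₗ (S13 n q ν₁ ν₃) ∘ₗ (S12 n q ν₁ ν₂) := by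
  have h3' : ∀ m, qPoch q ν₂ m ≠ 0
    | 0 => one_ne_zero
    | m + 1 => h3 _ m.succ_pos
  have h4' : ∀ m, qPoch q ν₃ m ≠ 0
    | 0 => one_ne_zero
    | m + 1 => h4 _ m.succ_pos
  refine Finsupp.lhom_ext' fun ⟨α, β, γ⟩ => LinearMap.ext_ring ?_
  simp only [LinearMap.comp_apply, Finsupp.lsingle_apply]
  rw [S12_S13_S23_single, S23_S13_S12_single]
  refine sum_congr rfl fun a _ => sum_congr rfl fun b _ => ?_
  rw [sum_Phi_eq hq0 hq h1 h2 h3' h4']
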